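/- arXiv:1808.09754 — 2 statements merged into one kernel-verified Lean document; each statement's English description precedes it below -/
import Mathlib

section
/- Let τ > √2 (so that θ_max ∈ (0, π/2)), let φ₁ > 0, and let Θ_C, Θ_Γ : (−φ₁, φ₁) → ℝ be smooth functions with Θ_C(0) = θ_max, Θ_Γ(0) = 0, Θ_C'(0) = 0 = Θ_Γ'(0) and Θ_C''(0) = −cot θ_max. Define C(ψ) = (cos Θ_C(ψ) cos ψ, cos Θ_C(ψ) sin ψ, sin Θ_C(ψ)) and Γ(φ) = (cos Θ_Γ(φ) cos φ, cos Θ_Γ(φ) sin φ, sin Θ_Γ(φ)). Then there exist ψ₂ ∈ (0, φ₁) and a constant c₀ > 0 such that for every ψ ∈ (−ψ₂, ψ₂) there exists φ with |φ| ≤ c₀ ψ² and ⟨Γ(φ), C(ψ)⟩ = cos θ_max (i.e. Γ(φ) ∈ K(C(ψ))); moreover, for ψ ≠ 0 the intersection is transversal, i.e. (d/dφ')⟨Γ(φ'), C(ψ)⟩|_{φ'=φ} ≠ 0. -/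
open MeasureTheory Set
open scoped RealInnerProductSpace ENNReal

noncomputable section

/-- Euclidean three-space. -/
abbrev E3 := EuclideanSpace ℝ (Fin 3)

/-- The unit sphere `S² ⊂ ℝ³`. -/
def Sphere2 : Set E3 := Metric.sphere 0 1

/-- The function `D(x,y) = (1/4)(1+⟨x,y⟩)(2 − τ²(1−⟨x,y⟩))`. -/
def Dfun (τ : ℝ) (x y : E3) : ℝ :=
  (1 / 4) * (1 + ⟪x, y⟫) * (2 - τ ^ 2 * (1 - ⟪x, y⟫))

/-- The Lagrangian `L = max(0, D)`. -/
def Lfun (τ : ℝ) (x y : E3) : ℝ := max 0 (Dfun τ x y)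

/-- The causal action of a measure. -/
def causalAction (τ : ℝ) (ρ : Measure E3) : ℝ :=
  ∫ x, ∫ y, Lfun τ x y ∂ρ ∂ρ

/-- `ρ` is a minimizing measure: a regular Borel probability measure supported on `S²`
minimizing the causal action among all such measures. -/
def IsMinimizer (τ : ℝ) (ρ : Measure E3) : Prop :=
  IsProbabilityMeasure ρ ∧ ρ.Regular ∧ ρ Sphere2ᶜ = 0 ∧
    ∀ ρ' : Measure E3, IsProbabilityMeasure ρ' → ρ'.Regular → ρ' Sphere2ᶜ = 0 →
      causalAction τ ρ ≤ causalAction τ ρ'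

/-- The support of a measure. -/
def msupport (ρ : Measure E3) : Set E3 :=
  {x | ∀ U : Set E3, IsOpen U → x ∈ U → 0 < ρ U}

/-- The opening angle `θ_max = arccos(1 − 2/τ²)`. -/
def θmax (τ : ℝ) : ℝ := Real.arccos (1 - 2 / τ ^ 2)

/-- The open light cone `I(p)`. -/
def lightConeI (τ : ℝ) (p : E3) : Set E3 := {q ∈ Sphere2 | 0 < Dfun τ p q}

/-- The boundary of the light cone `K(p)`. -/
def lightConeK (τ : ℝ) (p : E3) : Set E3 :=
  {q ∈ Sphere2 | ⟪p, q⟫ = Real.cos (θmax τ)}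

/-- Make a point of `ℝ³` from coordinates. -/
def mkE3 (a b c : ℝ) : E3 := (WithLp.equiv 2 (Fin 3 → ℝ)).symm ![a, b, c]

/-- A totally timelike set. -/
def TotallyTimelike (τ : ℝ) (Ω : Set E3) : Prop := ∀ x ∈ Ω, ∀ y ∈ Ω, 0 < Dfun τ x y

/-- `p` is an accumulation point of `A`: every neighborhood of `p` contains a point
of `A` different from `p`. -/
def AccumulationPt (p : E3) (A : Set E3) : Prop :=
  ∀ U ∈ nhds p, ∃ x ∈ A, x ∈ U ∧ x ≠ p

/-- `γ(0)` is a uniform two-sided accumulation point (of points of `M`) on `γ` of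
scaling `β`, where `γ` is defined on `(−δ, δ)`. -/
def UniformTwoSidedAcc (M : Set E3) (β δ : ℝ) (γ : ℝ → E3) : Prop :=
  ∃ ε₀ : ℝ, 0 < ε₀ ∧ ε₀ < δ ∧ ∀ ε : ℝ, 0 < ε → ε ≤ ε₀ →
    (∃ t ∈ Set.Ioo (-ε) (-(ε ^ (1 + β))), γ t ∈ M) ∧
    (∃ t ∈ Set.Ioo (ε ^ (1 + β)) ε, γ t ∈ M)

/-- The point `q₁ = (cos θ_max, 0, sin θ_max)`. -/
def q1pt (τ : ℝ) : E3 := mkE3 (Real.cos (θmax τ)) 0 (Real.sin (θmax τ))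

/-- The point `q₂ = (cos θ_max, 0, −sin θ_max)`. -/
def q2pt (τ : ℝ) : E3 := mkE3 (Real.cos (θmax τ)) 0 (-Real.sin (θmax τ))

/-- The curve `p_s = (cos s, sin s, 0)` along the equator. -/
def pcurve (s : ℝ) : E3 := mkE3 (Real.cos s) (Real.sin s) 0

/-- Geodesic ball in `S²` of radius `r` around `q`. -/
def geoBall (q : E3) (r : ℝ) : Set E3 := {x ∈ Sphere2 | Real.arccos ⟪q, x⟫ < r}

/-- The set `U_r = (B_r(q₁) ∪ B_r(q₂)) ∖ {q₁, q₂}`. -/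
def Uset (τ r : ℝ) : Set E3 := (geoBall (q1pt τ) r ∪ geoBall (q2pt τ) r) \ {q1pt τ, q2pt τ}

/-- The set `I_r(q) = I(q) ∖ U_r`. -/
def Iset (τ r : ℝ) (q : E3) : Set E3 := lightConeI τ q \ Uset τ r

/-- The point of `S²` with latitude `θ` (measured from the equator) and longitude `φ`. -/
def sphPt (θ φ : ℝ) : E3 :=
  mkE3 (Real.cos θ * Real.cos φ) (Real.cos θ * Real.sin φ) (Real.sin θ)

/-- The restrictions to `Ω` of polynomials of degree at most two on `ℝ³`. -/
def polyRestrictSet (Ω : Set E3) : Set (Ω → ℝ) :=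
  {f | ∃ P : MvPolynomial (Fin 3) ℝ, P.totalDegree ≤ 2 ∧
        ∀ x : Ω, f x = MvPolynomial.eval (fun i => (x : E3) i) P}

/-- The space `K(Ω)` of restrictions to `Ω` of polynomials of degree at most two. -/
def KSpace (Ω : Set E3) : Submodule ℝ (Ω → ℝ) := Submodule.span ℝ (polyRestrictSet Ω)

/-- Two-dimensional Hausdorff (surface) measure on `S²` restricted to `Ω`, as a
measure on `Ω`. -/
def surfΩ (Ω : Set E3) : Measure Ω := Measure.comap Subtype.val (μH[2] : Measure E3)

/-- The bilinear form `B(f,g) = ∫_Ω ∫_Ω D(x,y) f(x) g(y) dμ(x) dμ(y)` on functions on `Ω`. -/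
def Bform (τ : ℝ) (Ω : Set E3) (f g : Ω → ℝ) : ℝ :=
  ∫ x, ∫ y, Dfun τ (x : E3) (y : E3) * f x * g y ∂(surfΩ Ω) ∂(surfΩ Ω)

end

/-- Integrating a power bound. -/
lemma aux_int (f f' : ℝ → ℝ) (n : ℕ) (δ K : ℝ) (hδ : 0 < δ) (hK : 0 ≤ K)
    (hd : ∀ x, |x| < δ → HasDerivAt f (f' x) x) (h0 : f 0 = 0)
    (hb : ∀ x, |x| < δ → |f' x| ≤ K * |x| ^ n) :
    ∀ x, |x| < δ → |f x| ≤ K * |x| ^ (n + 1) := by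
  intro x hx
  have hsub : ∀ y ∈ Metric.closedBall (0:ℝ) |x|, |y| ≤ |x| := by
    intro y hy
    simpa using hy
  have := (convex_closedBall (0:ℝ) |x|).norm_image_sub_le_of_norm_hasDerivWithin_le
    (f := f) (f' := f') (C := K * |x| ^ n) (x := 0) (y := x)
    (fun y hy => (hd y ((hsub y hy).trans_lt hx)).hasDerivWithinAt)
    (fun y hy => (hb y ((hsub y hy).trans_lt hx)).trans (by
      have := hsub y hy
      gcongr))
    (by simp) (by simp)
  simp only [h0, sub_zero, Real.norm_eq_abs] at this
  rw [pow_succ, ← mul_assoc]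
  exact this

lemma aux_lin (f : ℝ → ℝ) (hf : DifferentiableAt ℝ f 0) (h0 : f 0 = 0) :
    ∃ δ > 0, ∃ K ≥ 0, ∀ x, |x| < δ → |f x| ≤ K * |x| := by
  have := hf.isBigO_sub
  simp only [h0, sub_zero] at this
  obtain ⟨K, hK, h⟩ := this.exists_nonneg
  rw [Asymptotics.IsBigOWith, Metric.eventually_nhds_iff] at h
  obtain ⟨δ, hδ, h⟩ := h
  exact ⟨δ, hδ, K, hK, fun x hx => by simpa using h (by simpa using hx)⟩

lemma aux_sin (u : ℝ) (hu : |u| ≤ 1) : |Real.sin u - u| ≤ u ^ 2 := by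
  have h := Real.sin_bound hu
  have h2 := sq_abs u
  have e1 : |u| ^ 5 ≤ |u| ^ 2 := pow_le_pow_of_le_one (abs_nonneg _) hu (by norm_num)
  have e2 : |u| ^ 3 ≤ |u| ^ 2 := pow_le_pow_of_le_one (abs_nonneg _) hu (by norm_num)
  rw [← abs_pow u 3] at e2
  have a1 := abs_le.1 h
  have a2 := abs_le.1 e2
  rw [abs_le]
  constructor <;> nlinarith [sq_nonneg u]

lemma aux_C (φ₁ : ℝ) (c s : ℝ) (hs : 0 < s) (hφ₁ : 0 < φ₁) (ΘC : ℝ → ℝ)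
    (hC : ∀ n : ℕ, ContDiffOn ℝ n ΘC (Set.Ioo (-φ₁) φ₁))
    (hc0 : Real.cos (ΘC 0) = c) (hs0 : Real.sin (ΘC 0) = s)
    (hC0' : deriv ΘC 0 = 0)
    (hC0'' : deriv (deriv ΘC) 0 = -(c / s)) :
    ∃ δ > 0, ∃ K ≥ 0, ∀ x, |x| < δ → |Real.cos (ΘC x) * Real.cos x - c| ≤ K * |x| ^ 3 := by
  have hopen : IsOpen (Set.Ioo (-φ₁) φ₁) := isOpen_Ioo
  have h1 : ContDiffOn ℝ 2 (deriv ΘC) (Set.Ioo (-φ₁) φ₁) :=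
    (hC 3).deriv_of_isOpen hopen (by norm_num)
  have h2 : ContDiffOn ℝ 1 (deriv (deriv ΘC)) (Set.Ioo (-φ₁) φ₁) :=
    h1.deriv_of_isOpen hopen (by norm_num)
  have mem : ∀ x, |x| < φ₁ → Set.Ioo (-φ₁) φ₁ ∈ nhds x := fun x hx =>
    hopen.mem_nhds (abs_lt.1 hx)
  have d0 : ∀ x, |x| < φ₁ → HasDerivAt ΘC (deriv ΘC x) x := fun x hx =>
    (((hC 3).contDiffAt (mem x hx)).differentiableAt (by norm_num)).hasDerivAt
  have d1 : ∀ x, |x| < φ₁ → HasDerivAt (deriv ΘC) (deriv (deriv ΘC) x) x := fun x hx =>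
    ((h1.contDiffAt (mem x hx)).differentiableAt (by norm_num)).hasDerivAt
  have d2 : DifferentiableAt ℝ (deriv (deriv ΘC)) 0 :=
    (h2.contDiffAt (mem 0 (by simpa))).differentiableAt (by norm_num)
  have e0 := (d0 0 (by simpa)).differentiableAt
  have e1 := (d1 0 (by simpa)).differentiableAt
  set k : ℝ → ℝ := fun x =>
    ((-(Real.cos (ΘC x) * deriv ΘC x)) * deriv ΘC x
      + (-Real.sin (ΘC x)) * deriv (deriv ΘC) x) * Real.cos x
    + (-Real.sin (ΘC x) * deriv ΘC x) * (-Real.sin x)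
    - ((-Real.sin (ΘC x) * deriv ΘC x) * Real.sin x + Real.cos (ΘC x) * Real.cos x) with hk
  have hkd : DifferentiableAt ℝ k 0 := by
    rw [hk]; fun_prop
  have hk0 : k 0 = 0 := by
    simp only [hk, hC0', hC0'', hc0, hs0, Real.sin_zero, Real.cos_zero]
    field_simp
    ring
  obtain ⟨δ, hδ, K, hK, hb⟩ := aux_lin k hkd hk0
  refine ⟨min δ φ₁, lt_min hδ hφ₁, K, hK, ?_⟩
  set k1 : ℝ → ℝ := fun x => (-Real.sin (ΘC x) * deriv ΘC x) * Real.cos x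
    - Real.cos (ΘC x) * Real.sin x with hk1
  have b1 := aux_int k1 k 1 (min δ φ₁) K (lt_min hδ hφ₁) hK (by
      intro x hx
      have hx' := (lt_min_iff.1 hx).2
      have D0 := d0 x hx'
      have D1 := d1 x hx'
      have := (((D0.sin.neg).mul D1).mul (Real.hasDerivAt_cos x)).sub
        (D0.cos.mul (Real.hasDerivAt_sin x))
      refine this.congr_deriv ?_
      simp only [hk, Pi.mul_apply, Pi.neg_apply]) (by simp [hk1, hC0'])
      (by intro x hx; simpa using hb x (lt_min_iff.1 hx).1)
  have b2 := aux_int (fun x => Real.cos (ΘC x) * Real.cos x - c) k1 2 (min δ φ₁) K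
      (lt_min hδ hφ₁) hK (by
      intro x hx
      have hx' := (lt_min_iff.1 hx).2
      have D0 := d0 x hx'
      have := (D0.cos.mul (Real.hasDerivAt_cos x)).sub_const c
      refine this.congr_deriv ?_
      simp only [hk1]
      ring) (by simp [hc0]) b1
  exact b2

lemma aux_inner (a b x y : ℝ) : ⟪sphPt a x, sphPt b y⟫ =
    Real.cos a * Real.cos b * Real.cos (x - y) + Real.sin a * Real.sin b := by
  rw [Real.cos_sub]
  simp [sphPt, mkE3, PiLp.inner_apply, Fin.sum_univ_three]
  ring

set_option maxHeartbeats 1000000 in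
lemma aux_main (φ₁ : ℝ) (c : ℝ) (hc : 0 < c) (hφ₁ : 0 < φ₁) (ΘC ΘΓ : ℝ → ℝ)
    (hCc : ContinuousAt ΘC 0)
    (hΓd : ∀ x, |x| < φ₁ → HasDerivAt ΘΓ (deriv ΘΓ x) x)
    (hΓd2 : DifferentiableAt ℝ (deriv ΘΓ) 0)
    (hc0 : Real.cos (ΘC 0) = c) (hΓ0 : ΘΓ 0 = 0) (hΓ0' : deriv ΘΓ 0 = 0)
    (hK : ∃ δ > 0, ∃ K ≥ 0, ∀ x, |x| < δ → |Real.cos (ΘC x) * Real.cos x - c| ≤ K * |x| ^ 3) :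
    ∃ ψ₂ : ℝ, 0 < ψ₂ ∧ ψ₂ < φ₁ ∧ ∃ c₀ : ℝ, 0 < c₀ ∧
      ∀ ψ ∈ Set.Ioo (-ψ₂) ψ₂, ∃ φ : ℝ, |φ| ≤ c₀ * ψ ^ 2 ∧
        Real.cos (ΘΓ φ) * Real.cos (ΘC ψ) * Real.cos (φ - ψ)
          + Real.sin (ΘΓ φ) * Real.sin (ΘC ψ) = c ∧
        (ψ ≠ 0 → deriv (fun φ => Real.cos (ΘΓ φ) * Real.cos (ΘC ψ) * Real.cos (φ - ψ)
          + Real.sin (ΘΓ φ) * Real.sin (ΘC ψ)) φ ≠ 0) := by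
  obtain ⟨δ₁, hδ₁, K, hK0, hK⟩ := hK
  obtain ⟨δ₂, hδ₂, A, hA0, hA⟩ := aux_lin _ hΓd2 hΓ0'
  have hΓc : ContinuousAt ΘΓ 0 := (hΓd 0 (by simpa)).continuousAt
  have hB : ∃ δ > 0, ∀ x y : ℝ, |x| < δ → |y| < δ →
      3 / 4 * c ≤ Real.cos (ΘΓ x) * Real.cos (ΘC y) := by
    have hcont : ContinuousAt (fun p : ℝ × ℝ => Real.cos (ΘΓ p.1) * Real.cos (ΘC p.2)) (0, 0) := by
      have a1 : ContinuousAt (fun p : ℝ × ℝ => ΘΓ p.1) (0, 0) :=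
        ContinuousAt.comp (f := Prod.fst) (g := ΘΓ) (x := ((0:ℝ), (0:ℝ))) hΓc continuousAt_fst
      have a2 : ContinuousAt (fun p : ℝ × ℝ => ΘC p.2) (0, 0) :=
        ContinuousAt.comp (f := Prod.snd) (g := ΘC) (x := ((0:ℝ), (0:ℝ))) hCc continuousAt_snd
      exact (Real.continuous_cos.continuousAt.comp a1).mul (Real.continuous_cos.continuousAt.comp a2)
    have hev := hcont.eventually (lt_mem_nhds (a := 3 / 4 * c) (by
      simp only [hΓ0, hc0, Real.cos_zero]; linarith))
    rw [Metric.eventually_nhds_iff] at hev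
    obtain ⟨δ, hδ, h⟩ := hev
    refine ⟨δ, hδ, fun x y hx hy => (h (y := (x, y)) ?_).le⟩
    rw [Prod.dist_eq]
    simpa using ⟨hx, hy⟩
  obtain ⟨δ₃, hδ₃, hB⟩ := hB
  -- constants
  set M : ℝ := 2 * (K + 1) / c with hM
  have hM0 : 0 < M := by positivity
  set Q : ℝ := M + 4 + 2 * A * M with hQ
  have hQ0 : 0 < Q := by positivity
  set δ : ℝ := min (min (min δ₁ δ₂) (min δ₃ φ₁)) (min (1 / 2) (min (1 / M) (c / (4 * Q)))) with hδdef
  have hδ : 0 < δ := by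
    simp only [hδdef, lt_min_iff]
    refine ⟨⟨⟨hδ₁, hδ₂⟩, hδ₃, hφ₁⟩, by norm_num, by positivity, by positivity⟩
  have hδφ : δ ≤ φ₁ := (min_le_left _ _).trans ((min_le_right _ _).trans (min_le_right _ _))
  refine ⟨δ / 2, by linarith, by linarith, M, hM0, ?_⟩
  intro ψ hψ
  have hψ' : |ψ| < δ / 2 := abs_lt.2 hψ
  have hψδ : |ψ| < δ := by linarith
  have hψδ' := hψδ
  rw [hδdef] at hψδ'
  simp only [lt_min_iff] at hψδ'
  obtain ⟨⟨⟨p1, p2⟩, p3, p4⟩, p5, p6, p7⟩ := hψδ'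
  rw [lt_div_iff₀ hM0] at p6
  rw [lt_div_iff₀ (by positivity)] at p7
  have hsq := sq_abs ψ
  have hab := abs_nonneg ψ
  have hsmall : M * ψ ^ 2 ≤ |ψ| := by rw [← hsq]; nlinarith
  -- derivative
  set F : ℝ → ℝ := fun φ => Real.cos (ΘΓ φ) * Real.cos (ΘC ψ) * Real.cos (φ - ψ)
          + Real.sin (ΘΓ φ) * Real.sin (ΘC ψ) with hF
  set G : ℝ → ℝ := fun φ => -Real.sin (ΘΓ φ) * deriv ΘΓ φ * Real.cos (ΘC ψ) * Real.cos (φ - ψ)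
          - Real.cos (ΘΓ φ) * Real.cos (ΘC ψ) * Real.sin (φ - ψ)
          + Real.cos (ΘΓ φ) * deriv ΘΓ φ * Real.sin (ΘC ψ) with hG
  have hFG : ∀ φ, |φ| ≤ M * ψ ^ 2 → HasDerivAt F (G φ) φ := by
    intro φ hφ
    have D := hΓd φ (by linarith)
    have := ((D.cos.mul_const (Real.cos (ΘC ψ))).mul
      (((hasDerivAt_id φ).sub_const ψ).cos)).add (D.sin.mul_const (Real.sin (ΘC ψ)))
    refine this.congr_deriv ?_
    simp only [hG, id]
    ring
  have hGb : ∀ φ, |φ| ≤ M * ψ ^ 2 → c / 2 * ψ ^ 2 ≤ ψ * G φ := by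
    intro φ hφ
    have hφψ : |φ| ≤ |ψ| := hφ.trans hsmall
    have q1 : |deriv ΘΓ φ| ≤ A * M * ψ ^ 2 := by
      have := hA φ (by linarith)
      nlinarith
    have q2 := hB φ ψ (by linarith) p3
    have q3 : |Real.sin (ψ - φ) - ψ| ≤ (M + 4) * ψ ^ 2 := by
      have hu : |ψ - φ| ≤ 2 * |ψ| := (abs_sub _ _).trans (by linarith)
      have h1 := aux_sin (ψ - φ) (by linarith)
      have h2 : (ψ - φ) ^ 2 ≤ 4 * ψ ^ 2 := by
        rw [← sq_abs (ψ - φ), ← hsq]; nlinarith [abs_nonneg (ψ - φ)]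
      have h3 : |Real.sin (ψ - φ) - ψ| ≤ |Real.sin (ψ - φ) - (ψ - φ)| + |φ| := by
        have := abs_add_le (Real.sin (ψ - φ) - (ψ - φ)) (-φ)
        rw [abs_neg] at this
        have e : Real.sin (ψ - φ) - ψ = Real.sin (ψ - φ) - (ψ - φ) + -φ := by ring
        rw [e]; exact this
      linarith
    set B := Real.cos (ΘΓ φ) * Real.cos (ΘC ψ) with hBdef
    have hB1 : |B| ≤ 1 := by
      rw [hBdef, abs_mul]
      exact mul_le_one₀ (Real.abs_cos_le_one _) (abs_nonneg _) (Real.abs_cos_le_one _)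
    set R := -Real.sin (ΘΓ φ) * Real.cos (ΘC ψ) * Real.cos (φ - ψ) +
      Real.cos (ΘΓ φ) * Real.sin (ΘC ψ) with hR
    have hR2 : |R| ≤ 2 := by
      have t1 : |-Real.sin (ΘΓ φ) * Real.cos (ΘC ψ) * Real.cos (φ - ψ)| ≤ 1 := by
        rw [abs_mul, abs_mul, abs_neg]
        exact mul_le_one₀ (mul_le_one₀ (Real.abs_sin_le_one _) (abs_nonneg _)
          (Real.abs_cos_le_one _)) (abs_nonneg _) (Real.abs_cos_le_one _)
      have t2 : |Real.cos (ΘΓ φ) * Real.sin (ΘC ψ)| ≤ 1 := by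
        rw [abs_mul]
        exact mul_le_one₀ (Real.abs_cos_le_one _) (abs_nonneg _) (Real.abs_sin_le_one _)
      exact (abs_add_le _ _).trans (by linarith)
    have hGe : ψ * G φ = B * ψ ^ 2 + (ψ * (B * (Real.sin (ψ - φ) - ψ)) + ψ * (R * deriv ΘΓ φ)) := by
      have : Real.sin (φ - ψ) = - Real.sin (ψ - φ) := by rw [← Real.sin_neg]; ring_nf
      simp only [hG, hR, hBdef, this]
      ring
    have r1 : |ψ * (B * (Real.sin (ψ - φ) - ψ))| ≤ |ψ| * (1 * ((M + 4) * ψ ^ 2)) := by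
      rw [abs_mul, abs_mul]; gcongr
    have r2 : |ψ * (R * deriv ΘΓ φ)| ≤ |ψ| * (2 * (A * M * ψ ^ 2)) := by
      rw [abs_mul, abs_mul]; gcongr
    have r3 : |ψ| * Q * ψ ^ 2 ≤ c / 4 * ψ ^ 2 := by
      apply mul_le_mul_of_nonneg_right _ (sq_nonneg _); linarith
    have r4 : 3 / 4 * c * ψ ^ 2 ≤ B * ψ ^ 2 := mul_le_mul_of_nonneg_right q2 (sq_nonneg _)
    rw [hGe]
    have := neg_abs_le (ψ * (B * (Real.sin (ψ - φ) - ψ)))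
    have := neg_abs_le (ψ * (R * deriv ΘΓ φ))
    rw [hQ] at r3
    nlinarith
  have hF0 : |ψ * (F 0 - c)| ≤ K * ψ ^ 4 := by
    have h := hK ψ p1
    have e : F 0 = Real.cos (ΘC ψ) * Real.cos ψ := by simp [hF, hΓ0]
    rw [e, abs_mul]
    calc _ ≤ |ψ| * (K * |ψ| ^ 3) := by gcongr
      _ = K * (|ψ| ^ 2) ^ 2 := by ring
      _ = _ := by rw [hsq]; ring
  set m := M * ψ ^ 2 with hm
  have hm0 : 0 ≤ m := by positivity
  -- monotone lower bound
  set H : ℝ → ℝ := fun φ => ψ * (F φ - c) - c / 2 * ψ ^ 2 * φ with hH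
  have hHd : ∀ φ, |φ| ≤ m → HasDerivAt H (ψ * G φ - c / 2 * ψ ^ 2) φ := by
    intro φ hφ
    have := (((hFG φ hφ).sub_const c).const_mul ψ).sub ((hasDerivAt_id φ).const_mul (c / 2 * ψ ^ 2))
    refine this.congr_deriv ?_
    ring
  have hHm : MonotoneOn H (Set.Icc (-m) m) := by
    apply monotoneOn_of_deriv_nonneg (convex_Icc _ _)
    · intro x hx
      exact (hHd x (abs_le.2 hx)).continuousAt.continuousWithinAt
    · intro x hx
      rw [interior_Icc] at hx
      exact (hHd x (abs_le.2 ⟨hx.1.le, hx.2.le⟩)).differentiableAt.differentiableWithinAt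
    · intro x hx
      rw [interior_Icc] at hx
      have hx' := abs_le.2 ⟨hx.1.le, hx.2.le⟩
      rw [(hHd x hx').deriv]
      linarith [hGb x hx']
  have z : (0:ℝ) ∈ Set.Icc (-m) m := ⟨by linarith, hm0⟩
  have g1 := hHm z (⟨by linarith, le_rfl⟩ : m ∈ Set.Icc (-m) m) hm0
  have g2 := hHm (⟨le_rfl, by linarith⟩ : -m ∈ Set.Icc (-m) m) z (by linarith)
  have hF0' := abs_le.1 hF0
  have hcm : c / 2 * ψ ^ 2 * m = (K + 1) * ψ ^ 4 := by
    rw [hm, hM]; field_simp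
  have h4 : 0 ≤ ψ ^ 4 := by positivity
  simp only [hH] at g1 g2
  have ivt := intermediate_value_Icc (f := fun φ => ψ * (F φ - c)) (a := -m) (b := m) (by linarith)
    (fun x hx => ((((hFG x (abs_le.2 hx)).sub_const c).const_mul
      ψ).continuousAt.continuousWithinAt))
  by_cases h0 : ψ = 0
  · refine ⟨0, by simpa using hm0, ?_, fun h => absurd h0 h⟩
    simp [hΓ0, h0, hc0]
  obtain ⟨φ, hφ, hφe⟩ := ivt (show (0:ℝ) ∈ _ by constructor <;> nlinarith)
  have hφ' := abs_le.2 hφ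
  refine ⟨φ, hφ', ?_, fun _ => ?_⟩
  · have : F φ - c = 0 := by simpa [h0] using hφe
    linarith
  · rw [(hFG φ hφ').deriv]
    intro h
    have := hGb φ hφ'
    rw [h, mul_zero] at this
    have : 0 < c / 2 * ψ ^ 2 := by positivity
    linarith

/-- Lemma 7.7: for an osculating curve `C` and the curve `Γ`, for
every small `ψ` there is `φ = O(ψ²)` with `Γ(φ) ∈ K(C(ψ))`, and the intersection is
transversal. -/
theorem stmt_17 (τ φ₁ : ℝ) (hτ : Real.sqrt 2 < τ) (hφ₁ : 0 < φ₁)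
    (ΘC ΘΓ : ℝ → ℝ)
    (hC : ∀ n : ℕ, ContDiffOn ℝ n ΘC (Set.Ioo (-φ₁) φ₁))
    (hΓ : ∀ n : ℕ, ContDiffOn ℝ n ΘΓ (Set.Ioo (-φ₁) φ₁))
    (hC0 : ΘC 0 = θmax τ) (hΓ0 : ΘΓ 0 = 0)
    (hC0' : deriv ΘC 0 = 0) (hΓ0' : deriv ΘΓ 0 = 0)
    (hC0'' : deriv (deriv ΘC) 0 = -(Real.cos (θmax τ) / Real.sin (θmax τ))) :
    ∃ ψ₂ : ℝ, 0 < ψ₂ ∧ ψ₂ < φ₁ ∧ ∃ c₀ : ℝ, 0 < c₀ ∧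
      ∀ ψ ∈ Set.Ioo (-ψ₂) ψ₂, ∃ φ : ℝ,
        |φ| ≤ c₀ * ψ ^ 2 ∧
        ⟪sphPt (ΘΓ φ) φ, sphPt (ΘC ψ) ψ⟫ = Real.cos (θmax τ) ∧
        (ψ ≠ 0 → deriv (fun φ' => ⟪sphPt (ΘΓ φ') φ', sphPt (ΘC ψ) ψ⟫) φ ≠ 0) := by
  have h2 : (2:ℝ) < τ ^ 2 := by
    have := Real.sq_sqrt (show (0:ℝ) ≤ 2 by norm_num)
    nlinarith [Real.sqrt_nonneg 2]
  have hfr : 2 / τ ^ 2 < 1 := by rw [div_lt_one (by linarith)]; exact h2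
  have hfr0 : 0 < 2 / τ ^ 2 := by positivity
  have hcos : Real.cos (θmax τ) = 1 - 2 / τ ^ 2 :=
    Real.cos_arccos (by linarith) (by linarith)
  have hc : 0 < Real.cos (θmax τ) := by rw [hcos]; linarith
  have hs : 0 < Real.sin (θmax τ) := by
    rw [θmax, Real.sin_arccos]
    apply Real.sqrt_pos.2
    nlinarith
  have hopen : IsOpen (Set.Ioo (-φ₁) φ₁) := isOpen_Ioo
  have mem : ∀ x, |x| < φ₁ → Set.Ioo (-φ₁) φ₁ ∈ nhds x := fun x hx =>
    hopen.mem_nhds (abs_lt.1 hx)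
  have h1 : ContDiffOn ℝ 1 (deriv ΘΓ) (Set.Ioo (-φ₁) φ₁) :=
    (hΓ 2).deriv_of_isOpen hopen (by norm_num)
  have hz : |(0:ℝ)| < φ₁ := by simpa
  simp only [aux_inner]
  exact aux_main φ₁ _ hc hφ₁ ΘC ΘΓ ((hC 1).contDiffAt (mem 0 hz)).continuousAt
    (fun x hx => (((hΓ 1).contDiffAt (mem x hx)).differentiableAt (by norm_num)).hasDerivAt)
    ((h1.contDiffAt (mem 0 hz)).differentiableAt (by norm_num)) (by rw [hC0]) hΓ0 hΓ0'
    (aux_C φ₁ _ _ hs hφ₁ ΘC hC (by rw [hC0]) (by rw [hC0]) hC0' hC0'')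
end

section
/- Let τ ≥ 1 and let γ : (−δ, δ) → S² be a smooth curve parametrized by arc length. Set c = −(1 + τ²)/4. Then there exist ε₀ ∈ (0, δ) and a constant C > 0 such that for all t, t' ∈ (−ε₀, ε₀): |L(γ(t), γ(t')) − 1 − c (t − t')²| ≤ C · (max(|t|, |t'|))⁴. -/
open MeasureTheory Set
open scoped RealInnerProductSpace ENNReal

theorem aux_int_s18 {F F' : ℝ → ℝ} {a b c M : ℝ} (n : ℕ) (hc : c ∈ Set.Icc a b) (hM : 0 ≤ M)
    (hF : ∀ x ∈ Set.Icc a b, HasDerivAt F (F' x) x) (h0 : F c = 0)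
    (hb : ∀ x ∈ Set.Icc a b, |F' x| ≤ M * |x - c| ^ n) :
    ∀ x ∈ Set.Icc a b, |F x| ≤ M * |x - c| ^ (n + 1) := by
  intro x hx
  have hsub : Set.uIcc c x ⊆ Set.Icc a b := Set.uIcc_subset_Icc hc hx
  have := (convex_uIcc c x).norm_image_sub_le_of_norm_hasDerivWithin_le
    (f := F) (f' := F') (C := M * |x - c| ^ n) (x := c) (y := x)
    (fun y hy => (hF y (hsub hy)).hasDerivWithinAt)
    (fun y hy => by
      rw [Real.norm_eq_abs]
      refine (hb y (hsub hy)).trans ?_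
      have : |y - c| ≤ |x - c| := Set.abs_sub_left_of_mem_uIcc hy
      gcongr)
    Set.left_mem_uIcc Set.right_mem_uIcc
  rw [h0, sub_zero, Real.norm_eq_abs, Real.norm_eq_abs] at this
  rw [pow_succ, ← mul_assoc]
  exact this

theorem aux_const {f : ℝ → ℝ} {f' k δ t : ℝ} (h : ∀ x ∈ Set.Ioo (-δ) δ, f x = k)
    (ht : t ∈ Set.Ioo (-δ) δ) (hf : HasDerivAt f f' t) : f' = 0 := by
  have h1 : HasDerivAt f 0 t := (hasDerivAt_const t k).congr_of_eventuallyEq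
    (Filter.eventually_of_mem (isOpen_Ioo.mem_nhds ht) h)
  exact hf.unique h1

theorem aux_deriv {γ : ℝ → E3} {δ : ℝ} (hsm : ∀ n : ℕ, ContDiffOn ℝ n γ (Set.Ioo (-δ) δ)) :
    (∀ n : ℕ, ContDiffOn ℝ n (deriv γ) (Set.Ioo (-δ) δ)) ∧
    (∀ t ∈ Set.Ioo (-δ) δ, HasDerivAt γ (deriv γ t) t) := by
  constructor
  · intro n
    exact (hsm (n + 1)).deriv_of_isOpen isOpen_Ioo (by norm_cast)
  · intro t ht
    exact (((hsm 1).differentiableOn (by norm_num)).differentiableAt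
      (isOpen_Ioo.mem_nhds ht)).hasDerivAt

theorem aux_taylor (δ : ℝ) (hδ : 0 < δ) (γ : ℝ → E3)
    (hsm : ∀ n : ℕ, ContDiffOn ℝ n γ (Set.Ioo (-δ) δ))
    (hmap : ∀ t ∈ Set.Ioo (-δ) δ, γ t ∈ Sphere2)
    (harc : ∀ t ∈ Set.Ioo (-δ) δ, ‖deriv γ t‖ = 1) :
    ∃ M : ℝ, 0 ≤ M ∧ ∀ t ∈ Set.Icc (-(δ/2)) (δ/2), ∀ c ∈ Set.Icc (-(δ/2)) (δ/2),
      |⟪γ t, γ c⟫ - 1 + (t - c) ^ 2 / 2| ≤ M * |t - c| ^ 4 := by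
  obtain ⟨s1, d0⟩ := aux_deriv hsm
  obtain ⟨s2, d1⟩ := aux_deriv s1
  obtain ⟨s3, d2⟩ := aux_deriv s2
  obtain ⟨s4, d3⟩ := aux_deriv s3
  set g1 := deriv γ
  set g2 := deriv g1
  set g3 := deriv g2
  set g4 := deriv g3
  have hsub : Set.Icc (-(δ/2)) (δ/2) ⊆ Set.Ioo (-δ) δ := fun x hx =>
    ⟨by linarith [hx.1], by linarith [hx.2]⟩
  obtain ⟨M, hM⟩ := isCompact_Icc.exists_bound_of_continuousOn ((s4 0).continuousOn.mono hsub)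
  have hnorm : ∀ t ∈ Set.Ioo (-δ) δ, ‖γ t‖ = 1 := fun t ht => by
    simpa [Sphere2] using hmap t ht
  have e00 : ∀ t ∈ Set.Ioo (-δ) δ, ⟪γ t, γ t⟫ = 1 := fun t ht => by
    rw [real_inner_self_eq_norm_sq, hnorm t ht]; norm_num
  have e11 : ∀ t ∈ Set.Ioo (-δ) δ, ⟪g1 t, g1 t⟫ = 1 := fun t ht => by
    rw [real_inner_self_eq_norm_sq, harc t ht]; norm_num
  have e10 : ∀ t ∈ Set.Ioo (-δ) δ, ⟪g1 t, γ t⟫ = 0 := fun t ht => by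
    have := aux_const e00 ht ((d0 t ht).inner ℝ (d0 t ht))
    rw [real_inner_comm] at this; linarith
  have e21 : ∀ t ∈ Set.Ioo (-δ) δ, ⟪g2 t, g1 t⟫ = 0 := fun t ht => by
    have := aux_const e11 ht ((d1 t ht).inner ℝ (d1 t ht))
    rw [real_inner_comm] at this; linarith
  have e20 : ∀ t ∈ Set.Ioo (-δ) δ, ⟪g2 t, γ t⟫ = -1 := fun t ht => by
    have := aux_const e10 ht ((d1 t ht).inner ℝ (d0 t ht))
    rw [e11 t ht] at this; linarith
  have e30 : ∀ t ∈ Set.Ioo (-δ) δ, ⟪g3 t, γ t⟫ = 0 := fun t ht => by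
    have := aux_const e20 ht ((d2 t ht).inner ℝ (d0 t ht))
    rw [e21 t ht] at this; linarith
  have h0mem : (0:ℝ) ∈ Set.Icc (-(δ/2)) (δ/2) := ⟨by linarith, by linarith⟩
  have hM0 : 0 ≤ M := (norm_nonneg _).trans (hM 0 h0mem)
  refine ⟨M, hM0, fun t ht c hc => ?_⟩
  have hc' := hsub hc
  have dd : ∀ {g g' : ℝ → E3}, (∀ t ∈ Set.Ioo (-δ) δ, HasDerivAt g (g' t) t) →
      ∀ x ∈ Set.Icc (-(δ/2)) (δ/2), HasDerivAt (fun x => ⟪g x, γ c⟫) ⟪g' x, γ c⟫ x := by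
    intro g g' h x hx
    simpa using (h x (hsub hx)).inner ℝ (hasDerivAt_const x (γ c))
  have b4 : ∀ x ∈ Set.Icc (-(δ/2)) (δ/2), |⟪g4 x, γ c⟫| ≤ M * |x - c| ^ 0 := fun x hx => by
    have := abs_real_inner_le_norm (g4 x) (γ c)
    rw [hnorm c hc', mul_one] at this
    simpa using this.trans (hM x hx)
  have b3 := aux_int_s18 (F := fun x => ⟪g3 x, γ c⟫) 0 hc hM0 (dd d3) (e30 c hc') b4
  have b2 := aux_int_s18 (F := fun x => ⟪g2 x, γ c⟫ + 1) 1 hc hM0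
    (fun x hx => (dd d2 x hx).add_const 1) (by simp [e20 c hc']) b3
  have b1 := aux_int_s18 (F := fun x => ⟪g1 x, γ c⟫ + (x - c)) 2 hc hM0
    (fun x hx => (dd d1 x hx).add ((hasDerivAt_id x).sub_const c)) (by simp [e10 c hc']) b2
  have b0 := aux_int_s18 (F := fun x => ⟪γ x, γ c⟫ - 1 + (x - c) ^ 2 / 2)
    (F' := fun x => ⟪g1 x, γ c⟫ + (x - c)) 3 hc hM0
    (fun x hx => by
      have h2 : HasDerivAt (fun y : ℝ => (y - c) ^ 2 / 2) (x - c) x := by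
        have := ((((hasDerivAt_id' x).sub_const c).fun_pow 2).div_const 2)
        refine this.congr_deriv ?_
        norm_num
      exact ((dd d0 x hx).sub_const 1).add h2) (by simp [hnorm c hc']) b1
  exact b0 t ht

/-- Lemma 7.8: quartic Taylor expansion of the Lagrangian along an
arc-length curve on the sphere, with `c = −(1+τ²)/4`. -/
theorem stmt_18 (τ δ : ℝ) (hτ : 1 ≤ τ) (hδ : 0 < δ) (γ : ℝ → E3)
    (hsm : ∀ n : ℕ, ContDiffOn ℝ n γ (Set.Ioo (-δ) δ))
    (hmap : ∀ t ∈ Set.Ioo (-δ) δ, γ t ∈ Sphere2)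
    (harc : ∀ t ∈ Set.Ioo (-δ) δ, ‖deriv γ t‖ = 1) :
    ∃ ε₀ : ℝ, 0 < ε₀ ∧ ε₀ < δ ∧ ∃ C : ℝ, 0 < C ∧
      ∀ t ∈ Set.Ioo (-ε₀) ε₀, ∀ t' ∈ Set.Ioo (-ε₀) ε₀,
        |Lfun τ (γ t) (γ t') - 1 - (-(1 + τ ^ 2) / 4) * (t - t') ^ 2| ≤
          C * max |t| |t'| ^ 4 := by
  obtain ⟨M, hM0, hM⟩ := aux_taylor δ hδ γ hsm hmap harc
  have hT : 0 < τ ^ 2 := by positivity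
  set T := τ ^ 2 with hTdef
  refine ⟨min (δ/2) (min (1/2) (1/(2 * (T * (1 + M))))), by positivity,
    (min_le_left _ _).trans_lt (by linarith),
    16 * ((1 + T) / 2 * M + T / 4 * (1 + M) ^ 2), by positivity, ?_⟩
  intro t ht c hc
  set ε := min (δ/2) (min (1/2) (1/(2 * (T * (1 + M))))) with hε
  have e1 : ε ≤ δ/2 := min_le_left _ _
  have e2 : ε ≤ 1/2 := (min_le_right _ _).trans (min_le_left _ _)
  have e3 : ε ≤ 1/(2 * (T * (1 + M))) := (min_le_right _ _).trans (min_le_right _ _)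
  have key := hM t ⟨by linarith [ht.1], by linarith [ht.2]⟩ c
    ⟨by linarith [hc.1], by linarith [hc.2]⟩
  have hh : |t - c| ≤ 2 * ε := abs_le.2 ⟨by linarith [ht.1, hc.2], by linarith [ht.2, hc.1]⟩
  have hmax : |t - c| ≤ 2 * max |t| |c| := by
    have := abs_sub t c
    linarith [le_max_left |t| |c|, le_max_right |t| |c|]
  rw [Lfun, Dfun]
  obtain ⟨s, hs⟩ : ∃ s, s = 1 - ⟪γ t, γ c⟫ := ⟨_, rfl⟩
  have hu : ⟪γ t, γ c⟫ = 1 - s := by linarith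
  rw [hu] at key ⊢
  rw [← sq_abs (t - c)] at key ⊢
  have hh0 : 0 ≤ |t - c| := abs_nonneg _
  generalize |t - c| = h at *
  have h4 : h ^ 4 ≤ 16 * max |t| |c| ^ 4 := by
    calc h ^ 4 ≤ (2 * max |t| |c|) ^ 4 := by gcongr
      _ = _ := by ring
  have h1 : h ≤ 1 := by linarith
  have h42 : h ^ 4 ≤ h ^ 2 := pow_le_pow_of_le_one hh0 h1 (by norm_num)
  have h21 : h ^ 2 ≤ h := by nlinarith
  obtain ⟨k1, k2⟩ := abs_le.1 key
  have hMh : M * h ^ 4 ≤ M * h ^ 2 := by gcongr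
  have hsabs : |s| ≤ (1 + M) * h ^ 2 := abs_le.2 ⟨by nlinarith, by nlinarith⟩
  have hTs : T * |s| ≤ 1 := by
    have : h ≤ 1 / (T * (1 + M)) := by
      refine hh.trans ((mul_le_mul_of_nonneg_left e3 (by norm_num)).trans (le_of_eq ?_))
      field_simp
    rw [le_div_iff₀ (by positivity)] at this
    calc T * |s| ≤ T * ((1 + M) * h ^ 2) := by gcongr
      _ ≤ T * ((1 + M) * h) := by gcongr
      _ ≤ 1 := by linarith
  have hs2 : s ≤ 2 := by
    have : |s| ≤ T * |s| := by
      have : 1 ≤ T := by rw [hTdef]; nlinarith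
      nlinarith [abs_nonneg s]
    linarith [le_abs_self s]
  have hTs' : T * s ≤ 1 := (mul_le_mul_of_nonneg_left (le_abs_self s) hT.le).trans hTs
  rw [max_eq_right (by
    have : 0 ≤ 1 + (1 - s) := by linarith
    have : 0 ≤ 2 - T * (1 - (1 - s)) := by linarith
    positivity)]
  have hsq : s ^ 2 ≤ (1 + M) ^ 2 * h ^ 4 := by
    calc s ^ 2 = |s| ^ 2 := (sq_abs s).symm
      _ ≤ ((1 + M) * h ^ 2) ^ 2 := by gcongr
      _ = _ := by ring
  have eq : 1 / 4 * (1 + (1 - s)) * (2 - T * (1 - (1 - s))) - 1 - -(1 + T) / 4 * h ^ 2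
      = (1 + T) / 2 * (1 - s - 1 + h ^ 2 / 2) + T / 4 * s ^ 2 := by ring
  rw [eq]
  calc _ ≤ |(1 + T) / 2 * (1 - s - 1 + h ^ 2 / 2)| + |T / 4 * s ^ 2| := abs_add_le _ _
    _ = (1 + T) / 2 * |1 - s - 1 + h ^ 2 / 2| + T / 4 * s ^ 2 := by
      rw [abs_mul, abs_of_nonneg (show 0 ≤ (1 + T) / 2 by positivity),
        abs_of_nonneg (show 0 ≤ T / 4 * s ^ 2 by positivity)]
    _ ≤ (1 + T) / 2 * (M * h ^ 4) + T / 4 * ((1 + M) ^ 2 * h ^ 4) := by gcongr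
    _ = ((1 + T) / 2 * M + T / 4 * (1 + M) ^ 2) * h ^ 4 := by ring
    _ ≤ ((1 + T) / 2 * M + T / 4 * (1 + M) ^ 2) * (16 * max |t| |c| ^ 4) := by gcongr
    _ = _ := by ring
end
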